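/- Suppose additionally that X has diameter smaller than D_κ/2. Let f,g : X → (−∞,∞] be two convex functions with complete sublevel sets. If x ∈ dom f ∩ dom g is a minimum point of f+g and f is continuous at x, then there exist ([γ],r) ∈ ∂f(x) and ([η],s) ∈ ∂g(x) such that ([γ],r) and ([η],s) are opposite to each other. -/

import Mathlib

/-!
Basic convex analysis in metric spaces with bounded curvature:
common definitions (geodesics, Alexandrov angles, tangent-space elements,
normal cones, subdifferentials, CAT(κ) conditions).
-/

open Metric Real Set Filter

noncomputable section

namespace CATPaper

/-- A geodesic of length `l` in a metric space `X`: a map `ℝ → X` that is isometric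
on `[0, l]` (values outside `[0, l]` are irrelevant). -/
structure Geodesic (X : Type*) [MetricSpace X] where
  l : ℝ
  l_nonneg : 0 ≤ l
  map : ℝ → X
  isom : ∀ s ∈ Set.Icc (0:ℝ) l, ∀ t ∈ Set.Icc (0:ℝ) l, dist (map s) (map t) = |s - t|

variable {X : Type*} [MetricSpace X]

/-- The constant geodesic at a point. -/
def constGeod (x : X) : Geodesic X :=
  ⟨0, le_rfl, fun _ => x, by
    rintro s ⟨hs0, hs1⟩ t ⟨ht0, ht1⟩
    have : s = t := by nlinarith
    simp [this]⟩

/-- `γ` is a geodesic from `x` to `y` (parametrized by arclength on `[0, d(x,y)]`). -/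
def GeodesicFromTo (γ : Geodesic X) (x y : X) : Prop :=
  γ.map 0 = x ∧ γ.l = dist x y ∧ γ.map γ.l = y

/-- Every two points of `X` are joined by a geodesic. -/
def GeodesicSpace (X : Type*) [MetricSpace X] : Prop :=
  ∀ x y : X, ∃ γ : Geodesic X, GeodesicFromTo γ x y

/-- Every two points of `X` are joined by a unique geodesic segment. -/
def UniquelyGeodesic (X : Type*) [MetricSpace X] : Prop :=
  ∀ (x y : X) (γ η : Geodesic X), GeodesicFromTo γ x y → GeodesicFromTo η x y →
    ∀ t ∈ Set.Icc (0:ℝ) (dist x y), γ.map t = η.map t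

/-- The geodesic extension property around `x` with constant `R`: any geodesic between
distinct points `y, z ∈ B(x,R)` with `d(y,z) < R` extends beyond `z` to a geodesic of
length `R`. -/
def GeodExtAround (x : X) (R : ℝ) : Prop :=
  ∀ y z : X, y ∈ Metric.ball x R → z ∈ Metric.ball x R → y ≠ z → dist y z < R →
    ∃ γ : Geodesic X, γ.l = R ∧ γ.map 0 = y ∧ γ.map (dist y z) = z

/-- The (global) geodesic extension property: every nondegenerate geodesic segment is
contained in a geodesic line. -/
def GeodExtGlobal (X : Type*) [MetricSpace X] : Prop :=
  ∀ γ : Geodesic X, 0 < γ.l → ∃ g : ℝ → X,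
    (∀ s t : ℝ, dist (g s) (g t) = |s - t|) ∧ ∀ t ∈ Set.Icc (0:ℝ) γ.l, g t = γ.map t

/-- The Euclidean comparison angle at the vertex `x` of the triple `(p, x, q)`. -/
def compAngle (x p q : X) : ℝ :=
  Real.arccos ((dist x p ^ 2 + dist x q ^ 2 - dist p q ^ 2) / (2 * dist x p * dist x q))

/-- The Alexandrov angle between two geodesics issuing at the same point: the limit as
`s, t ↘ 0` of the Euclidean comparison angles (junk value if the limit does not exist). -/
def alexAngle (γ η : Geodesic X) : ℝ :=
  limUnder ((nhdsWithin (0:ℝ) (Set.Ioi 0)) ×ˢ (nhdsWithin (0:ℝ) (Set.Ioi 0)))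
    (fun p : ℝ × ℝ => compAngle (γ.map 0) (γ.map p.1) (η.map p.2))

/-- `([γ], r)` is an element of the tangent space at `x`: `γ` issues at `x`, `r ≥ 0`, and
`γ` is nonconstant unless `r = 0` (in which case `([γ], r)` is the origin `o_x`). -/
def InTangent (x : X) (γ : Geodesic X) (r : ℝ) : Prop :=
  γ.map 0 = x ∧ 0 ≤ r ∧ (r = 0 ∨ 0 < γ.l)

/-- Equality of directions `[γ] = [η]` (equivalence classes under zero Alexandrov angle;
constant geodesics all represent the degenerate direction). -/
def DirEq (γ η : Geodesic X) : Prop :=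
  (γ.l = 0 ∧ η.l = 0) ∨ (0 < γ.l ∧ 0 < η.l ∧ alexAngle γ η = 0)

/-- The scalar product `⟨([γ], r), ([η], s)⟩ = r·s·cos ∠(γ, η)` of two tangent-space
elements. -/
def tInner (γ : Geodesic X) (r : ℝ) (η : Geodesic X) (s : ℝ) : ℝ :=
  r * s * Real.cos (alexAngle γ η)

/-- The tangent-space elements `([γ], r)` and `([η], s)` are opposite to each other. -/
def TanOpposite (γ : Geodesic X) (r : ℝ) (η : Geodesic X) (s : ℝ) : Prop :=
  (r = 0 ∧ s = 0) ∨ (r = s ∧ 0 < r ∧ alexAngle γ η = π)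

/-- The metric projection of `z` onto `C`: the set of points of `C` nearest to `z`. -/
def projSet (C : Set X) (z : X) : Set X :=
  {y ∈ C | ∀ c ∈ C, dist z y ≤ dist z c}

/-- A set is convex if it contains every geodesic segment between its points. -/
def GConvex (C : Set X) : Prop :=
  ∀ γ : Geodesic X, γ.map 0 ∈ C → γ.map γ.l ∈ C → ∀ t ∈ Set.Icc (0:ℝ) γ.l, γ.map t ∈ C

/-- `([γ], r)` belongs to the normal cone of `C` at `x`: `r = 0`, or `x` is the metric
projection onto `C` of `γ(t)` for some `t > 0`. -/
def InNormalCone (C : Set X) (x : X) (γ : Geodesic X) (r : ℝ) : Prop :=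
  r = 0 ∨ ∃ t : ℝ, 0 < t ∧ t ≤ γ.l ∧ projSet C (γ.map t) = {x}

/-- The diameter `D_κ = π/√κ` of the model space `M_κ²` for `κ > 0`. -/
def Dk (κ : ℝ) : ℝ := π / Real.sqrt κ

/-- The comparison distance in the model sphere `M_κ²` of curvature `κ > 0`: the distance
from the vertex `p̄` to the point at arclength `t` along the side `q̄ r̄` of a comparison
triangle with `d(q,r) = a`, `d(p,q) = b`, `d(p,r) = c`, computed via the spherical law of
cosines. -/
def modelCompDist (κ a b c t : ℝ) : ℝ :=
  (1 / Real.sqrt κ) * Real.arccos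
    (Real.cos (Real.sqrt κ * b) * Real.cos (Real.sqrt κ * t) +
      Real.sin (Real.sqrt κ * b) * Real.sin (Real.sqrt κ * t) *
        ((Real.cos (Real.sqrt κ * c) - Real.cos (Real.sqrt κ * a) * Real.cos (Real.sqrt κ * b)) /
          (Real.sin (Real.sqrt κ * a) * Real.sin (Real.sqrt κ * b))))

/-- `X` is a `CAT(κ)` space for `κ > 0`: every two points at distance `< D_κ` are joined
by a geodesic, and every geodesic triangle of perimeter `< 2 D_κ` is no thicker than its
comparison triangle in the model sphere `M_κ²`. -/
def IsCATK (κ : ℝ) (X : Type*) [MetricSpace X] : Prop :=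
  (∀ x y : X, dist x y < Dk κ → ∃ γ : Geodesic X, GeodesicFromTo γ x y) ∧
  (∀ (p : X) (σ : Geodesic X),
    dist p (σ.map 0) + dist p (σ.map σ.l) + σ.l < 2 * Dk κ →
    ∀ t ∈ Set.Icc (0:ℝ) σ.l,
      dist p (σ.map t) ≤ modelCompDist κ σ.l (dist p (σ.map 0)) (dist p (σ.map σ.l)) t)

/-- `X` is a `CAT(0)` space: a geodesic space satisfying the `CAT(0)` comparison
inequality `d(z, γ(t·l))² ≤ (1-t)·d(z,γ(0))² + t·d(z,γ(l))² - t(1-t)·l²`. -/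
def IsCAT0 (X : Type*) [MetricSpace X] : Prop :=
  GeodesicSpace X ∧
  ∀ (z : X) (γ : Geodesic X), ∀ t ∈ Set.Icc (0:ℝ) 1,
    dist z (γ.map (t * γ.l)) ^ 2 ≤
      (1 - t) * dist z (γ.map 0) ^ 2 + t * dist z (γ.map γ.l) ^ 2 - t * (1 - t) * γ.l ^ 2

/-- The standing assumptions of the paper: `(X,d)` is a locally compact, uniquely geodesic
`CAT(κ)` space (`κ > 0`) having, around every point `x`, the geodesic extension property
with a constant `R x < D_κ/2`. -/
structure Standing (κ : ℝ) (X : Type*) [MetricSpace X] (R : X → ℝ) : Prop where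
  kpos : 0 < κ
  locComp : LocallyCompactSpace X
  cat : IsCATK κ X
  geod : GeodesicSpace X
  unique : UniquelyGeodesic X
  Rpos : ∀ x : X, 0 < R x
  Rsmall : ∀ x : X, R x < Dk κ / 2
  ext : ∀ x : X, GeodExtAround x (R x)

/-- A function `f : X → (-∞, ∞]` is convex if
`f(γ(t·l)) ≤ (1-t)·f(γ(0)) + t·f(γ(l))` along every geodesic. -/
def GConvexFn (f : X → EReal) : Prop :=
  ∀ (γ : Geodesic X), ∀ t ∈ Set.Icc (0:ℝ) 1,
    f (γ.map (t * γ.l)) ≤ ((1 - t : ℝ) : EReal) * f (γ.map 0) + (t : EReal) * f (γ.map γ.l)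

/-- The product `X × ℝ` equipped with the metric
`d₂((x₁,λ₁),(x₂,λ₂)) = √(d(x₁,x₂)² + |λ₁-λ₂|²)`. -/
abbrev XR (X : Type*) [MetricSpace X] : Type _ := WithLp 2 (X × ℝ)

/-- The point `(x, a)` of `X × ℝ`. -/
def toXR (x : X) (a : ℝ) : XR X := (WithLp.equiv 2 (X × ℝ)).symm (x, a)

/-- The epigraph of `f : X → (-∞, ∞]`, as a subset of `X × ℝ`. -/
def epigraph (f : X → EReal) : Set (XR X) :=
  {p : XR X | f ((WithLp.equiv 2 (X × ℝ)) p).1 ≤ ((((WithLp.equiv 2 (X × ℝ)) p).2 : ℝ) : EReal)}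

/-- `([γ], r) ∈ ∂f(x)`: the geodesic `σ(t) = (γ(rt/√(r²+1)), f(x) - t/√(r²+1))`,
`t ∈ [0, R₀]`, in `X × ℝ` satisfies `([σ], 1) ∈ N_{epi f}(x, f(x))`. -/
def IsSubgrad (R₀ : ℝ) (f : X → EReal) (x : X) (γ : Geodesic X) (r : ℝ) : Prop :=
  ∃ σ : Geodesic (XR X), σ.l = R₀ ∧
    (∀ t : ℝ, σ.map t =
      toXR (γ.map (r * t / Real.sqrt (r ^ 2 + 1)))
        ((f x).toReal - t / Real.sqrt (r ^ 2 + 1))) ∧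
    InNormalCone (epigraph f) (toXR x (f x).toReal) σ 1

/-- `([γ], r) ∈ ∂f(x)` in the `CAT(0)` setting, where the defining geodesic `σ` may be
taken on any interval `[0, l]`, `l > 0`. -/
def IsSubgrad0 (f : X → EReal) (x : X) (γ : Geodesic X) (r : ℝ) : Prop :=
  ∃ σ : Geodesic (XR X), 0 < σ.l ∧
    (∀ t : ℝ, σ.map t =
      toXR (γ.map (r * t / Real.sqrt (r ^ 2 + 1)))
        ((f x).toReal - t / Real.sqrt (r ^ 2 + 1))) ∧
    InNormalCone (epigraph f) (toXR x (f x).toReal) σ 1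

end CATPaper

namespace CATPaper
section

variable {X : Type*} [MetricSpace X]

/-- The reversed geodesic. -/
def Geodesic.rev (γ : Geodesic X) : Geodesic X :=
  ⟨γ.l, γ.l_nonneg, fun t => γ.map (γ.l - t), by
    rintro s ⟨hs0, hs1⟩ t ⟨ht0, ht1⟩
    rw [γ.isom _ ⟨by linarith, by linarith⟩ _ ⟨by linarith, by linarith⟩, abs_sub_comm]
    congr 1
    ring⟩

/-- The restriction of a geodesic to `[u, v]`, reparametrized on `[0, v - u]`. -/
def Geodesic.restrict (γ : Geodesic X) (u v : ℝ) (hu : 0 ≤ u) (huv : u ≤ v) (hv : v ≤ γ.l) :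
    Geodesic X :=
  ⟨v - u, by linarith, fun t => γ.map (u + t), by
    rintro s ⟨hs0, hs1⟩ t ⟨ht0, ht1⟩
    rw [γ.isom _ ⟨by linarith, by linarith⟩ _ ⟨by linarith, by linarith⟩]
    congr 1
    ring⟩

lemma Geodesic.dist_zero_map (γ : Geodesic X) {t : ℝ} (ht : t ∈ Set.Icc 0 γ.l) :
    dist (γ.map 0) (γ.map t) = t := by
  rw [γ.isom 0 ⟨le_rfl, γ.l_nonneg⟩ t ht, zero_sub, abs_neg, abs_of_nonneg ht.1]

lemma Geodesic.dist_map_of_le (γ : Geodesic X) {s t : ℝ} (hs : 0 ≤ s) (hst : s ≤ t)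
    (ht : t ≤ γ.l) : dist (γ.map s) (γ.map t) = t - s := by
  rw [γ.isom s ⟨hs, hst.trans ht⟩ t ⟨hs.trans hst, ht⟩, abs_sub_comm,
    abs_of_nonneg (sub_nonneg.2 hst)]

/-- The comparison inequality for geodesic triangles, in terms of cosines of distances. -/
def CosComparison (k : ℝ) (X : Type*) [MetricSpace X] : Prop :=
  ∀ (p : X) (σ : Geodesic X), ∀ t ∈ Set.Icc (0 : ℝ) σ.l,
    cos (k * dist p (σ.map 0)) * sin (k * (σ.l - t)) + cos (k * dist p (σ.map σ.l)) * sin (k * t)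
      ≤ cos (k * dist p (σ.map t)) * sin (k * σ.l)

lemma sphericalCosine_mul_sin {a b c t : ℝ} (ha : 0 < a) (ha' : a < π) (hb : 0 < b)
    (hb' : b < π) :
    (cos b * cos t + sin b * sin t * ((cos c - cos a * cos b) / (sin a * sin b))) * sin a =
      cos b * sin (a - t) + cos c * sin t := by
  have h1 := (sin_pos_of_pos_of_lt_pi ha ha').ne'
  have h2 := (sin_pos_of_pos_of_lt_pi hb hb').ne'
  rw [sin_sub]
  field_simp
  ring

lemma sphericalCosine_le_one {a b c t : ℝ} (ha : 0 < a) (ha' : a < π) (hb : 0 < b)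
    (hb' : b < π) (hc : c ≤ π) (h : |a - b| ≤ c) (ht : 0 ≤ t) (ht' : t ≤ π) :
    cos b * cos t + sin b * sin t * ((cos c - cos a * cos b) / (sin a * sin b)) ≤ 1 := by
  have h1 := sin_pos_of_pos_of_lt_pi ha ha'
  have h2 := sin_pos_of_pos_of_lt_pi hb hb'
  have h3 : cos c ≤ cos (a - b) := by
    rw [← cos_abs (a - b)]
    exact cos_le_cos_of_nonneg_of_le_pi (abs_nonneg _) hc h
  have h4 : (cos c - cos a * cos b) / (sin a * sin b) ≤ 1 := by
    rw [div_le_one (mul_pos h1 h2)]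
    rw [cos_sub] at h3
    linarith
  have h5 : 0 ≤ sin b * sin t := mul_nonneg h2.le (sin_nonneg_of_nonneg_of_le_pi ht ht')
  have h6 := mul_le_mul_of_nonneg_left h4 h5
  have h7 := cos_le_one (b - t)
  rw [cos_sub] at h7
  linarith

lemma IsCATK.cosComparison {κ : ℝ} (hκ : 0 < κ) (h : IsCATK κ X)
    (hd : ∀ p q : X, √κ * dist p q < π / 2) : CosComparison (√κ) X := by
  have hk : 0 < √κ := Real.sqrt_pos.2 hκ
  rintro p σ t ⟨ht0, ht1⟩
  have hl : dist (σ.map 0) (σ.map σ.l) = σ.l := σ.dist_zero_map ⟨σ.l_nonneg, le_rfl⟩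
  rcases eq_or_lt_of_le σ.l_nonneg with hl0 | hl0
  · have : t = 0 := by linarith
    subst this
    simp [← hl0]
  rcases eq_or_lt_of_le (dist_nonneg (x := p) (y := σ.map 0)) with hb | hb
  · have hp : p = σ.map 0 := dist_eq_zero.1 hb.symm
    rw [hp, hl, σ.dist_zero_map ⟨ht0, ht1⟩, dist_self, mul_sub, sin_sub]
    apply le_of_eq
    simp only [mul_zero, cos_zero]
    ring
  have ha := hd (σ.map 0) (σ.map σ.l)
  rw [hl] at ha
  have hb1 := hd p (σ.map 0)
  have hc1 := hd p (σ.map σ.l)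
  have hper : dist p (σ.map 0) + dist p (σ.map σ.l) + σ.l < 2 * Dk κ := by
    rw [Dk, ← mul_div_assoc, lt_div_iff₀ hk]
    nlinarith [pi_pos]
  have hπ := pi_pos
  have hkt : √κ * t ≤ √κ * σ.l := mul_le_mul_of_nonneg_left ht1 hk.le
  have hmain := h.2 p σ hper t ⟨ht0, ht1⟩
  rw [modelCompDist, one_div, inv_mul_eq_div, le_div_iff₀ hk, mul_comm] at hmain
  have htri : |√κ * σ.l - √κ * dist p (σ.map 0)| ≤ √κ * dist p (σ.map σ.l) := by
    rw [← mul_sub, abs_mul, abs_of_pos hk]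
    refine mul_le_mul_of_nonneg_left ?_ hk.le
    rw [abs_le]
    have e1 := dist_triangle_left (σ.map 0) (σ.map σ.l) p
    have e2 := dist_triangle p (σ.map σ.l) (σ.map 0)
    rw [dist_comm (σ.map σ.l)] at e2
    constructor <;> linarith
  have hle := sphericalCosine_le_one (mul_pos hk hl0) (by linarith) (mul_pos hk hb)
    (by linarith) (by linarith) htri (mul_nonneg hk.le ht0) (by linarith)
  have hmul := sphericalCosine_mul_sin (c := √κ * dist p (σ.map σ.l)) (t := √κ * t)
    (mul_pos hk hl0) (by linarith) (mul_pos hk hb) (by linarith)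
  set E := cos (√κ * dist p (σ.map 0)) * cos (√κ * t) +
      sin (√κ * dist p (σ.map 0)) * sin (√κ * t) *
        ((cos (√κ * dist p (σ.map σ.l)) - cos (√κ * σ.l) * cos (√κ * dist p (σ.map 0))) /
          (sin (√κ * σ.l) * sin (√κ * dist p (σ.map 0)))) with hE
  have hcos : E ≤ cos (√κ * dist p (σ.map t)) := by
    rcases le_or_gt (-1) E with h1 | h1
    · rw [← cos_arccos h1 hle]
      exact cos_le_cos_of_nonneg_of_le_pi (mul_nonneg hk.le dist_nonneg) (arccos_le_pi _) hmain
    · exact h1.le.trans (neg_one_le_cos _)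
  rw [mul_sub, ← hmul]
  exact mul_le_mul_of_nonneg_right hcos
    (sin_nonneg_of_nonneg_of_le_pi (mul_nonneg hk.le σ.l_nonneg) (by linarith))

lemma mul_sin_le_sin_mul {u a : ℝ} (hu0 : 0 ≤ u) (hu1 : u ≤ 1) (ha0 : 0 ≤ a) (ha : a ≤ π) :
    u * sin a ≤ sin (u * a) := by
  have := strictConcaveOn_sin_Icc.concaveOn.2 (x := 0) (y := a) ⟨le_rfl, pi_pos.le⟩ ⟨ha0, ha⟩
    (sub_nonneg.2 hu1) hu0 (by ring)
  simpa using this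

/-- Along a geodesic, the cosine of the distance to a fixed point is concave. -/
lemma CosComparison.concave {k : ℝ} (hk : 0 < k) (hd : ∀ p q : X, k * dist p q < π / 2)
    (h : CosComparison k X) (p : X) (σ : Geodesic X) {u : ℝ} (hu0 : 0 ≤ u) (hu1 : u ≤ 1) :
    (1 - u) * cos (k * dist p (σ.map 0)) + u * cos (k * dist p (σ.map σ.l))
      ≤ cos (k * dist p (σ.map (u * σ.l))) := by
  have hpos : ∀ q, 0 ≤ cos (k * dist p q) := fun q =>
    cos_nonneg_of_mem_Icc ⟨by
      have := mul_nonneg hk.le (dist_nonneg (x := p) (y := q))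
      linarith [pi_pos], (hd p q).le⟩
  rcases eq_or_lt_of_le σ.l_nonneg with hl0 | hl0
  · simp only [← hl0, mul_zero]
    apply le_of_eq
    ring
  have hl : k * σ.l < π / 2 := by
    have := hd (σ.map 0) (σ.map σ.l)
    rwa [σ.dist_zero_map ⟨σ.l_nonneg, le_rfl⟩] at this
  have hkl := mul_pos hk hl0
  have hπ := pi_pos
  have hs : 0 < sin (k * σ.l) := sin_pos_of_pos_of_lt_pi hkl (by linarith)
  have h1 := h p σ (u * σ.l) ⟨mul_nonneg hu0 hl0.le, by nlinarith⟩
  have h2 := mul_sin_le_sin_mul (sub_nonneg.2 hu1) (by linarith) hkl.le (by linarith)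
  have h3 := mul_sin_le_sin_mul hu0 hu1 hkl.le (by linarith)
  rw [show k * (σ.l - u * σ.l) = (1 - u) * (k * σ.l) by ring,
    show k * (u * σ.l) = u * (k * σ.l) by ring] at h1
  refine le_of_mul_le_mul_right ?_ hs
  nlinarith [mul_le_mul_of_nonneg_left h2 (hpos (σ.map 0)),
    mul_le_mul_of_nonneg_left h3 (hpos (σ.map σ.l))]

/-- The midpoint of two distinct points equidistant from `p` is strictly closer to `p`. -/
lemma CosComparison.dist_midpoint_lt {k : ℝ} (hk : 0 < k)
    (hd : ∀ p q : X, k * dist p q < π / 2) (h : CosComparison k X) (p : X) (σ : Geodesic X)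
    (hl0 : 0 < σ.l) (heq : dist p (σ.map 0) = dist p (σ.map σ.l)) :
    dist p (σ.map (1 / 2 * σ.l)) < dist p (σ.map 0) := by
  by_contra! hcon
  have hl : k * σ.l < π / 2 := by
    have := hd (σ.map 0) (σ.map σ.l)
    rwa [σ.dist_zero_map ⟨σ.l_nonneg, le_rfl⟩] at this
  have hkl := mul_pos hk hl0
  have hπ := pi_pos
  have h1 := h p σ (1 / 2 * σ.l) ⟨by linarith, by linarith⟩
  rw [← heq, show k * (σ.l - 1 / 2 * σ.l) = k * σ.l / 2 by ring,
    show k * (1 / 2 * σ.l) = k * σ.l / 2 by ring,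
    show k * σ.l = 2 * (k * σ.l / 2) by ring, sin_two_mul] at h1
  set θ := k * σ.l / 2 with hθ
  rw [show 2 * θ / 2 = θ by ring] at h1
  have hs : 0 < sin θ := sin_pos_of_pos_of_lt_pi (by linarith) (by linarith)
  have hc : cos θ < 1 := by
    have := strictAntiOn_cos ⟨le_rfl, hπ.le⟩ (⟨by linarith, by linarith⟩ : θ ∈ Set.Icc 0 π)
      (by linarith)
    simpa using this
  have hc0 : 0 < cos θ := cos_pos_of_mem_Ioo ⟨by linarith, by linarith⟩
  have hpos : 0 < cos (k * dist p (σ.map 0)) := cos_pos_of_mem_Ioo ⟨by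
    have := mul_nonneg hk.le (dist_nonneg (x := p) (y := σ.map 0))
    linarith, hd _ _⟩
  have hmono : cos (k * dist p (σ.map (1 / 2 * σ.l))) ≤ cos (k * dist p (σ.map 0)) :=
    cos_le_cos_of_nonneg_of_le_pi (mul_nonneg hk.le dist_nonneg)
      (by linarith [hd p (σ.map (1 / 2 * σ.l))]) (mul_le_mul_of_nonneg_left hcon hk.le)
  have h2 : 2 * cos (k * dist p (σ.map 0)) ≤ 2 * cos (k * dist p (σ.map (1 / 2 * σ.l))) * cos θ := by
    refine le_of_mul_le_mul_right ?_ hs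
    linarith
  nlinarith

lemma GConvexFn.le_of_le {h : X → EReal} (hc : GConvexFn h) (σ : Geodesic X) {a b u : ℝ}
    (ha : h (σ.map 0) ≤ a) (hb : h (σ.map σ.l) ≤ b) (hu0 : 0 ≤ u) (hu1 : u ≤ 1) :
    h (σ.map (u * σ.l)) ≤ ((1 - u) * a + u * b : ℝ) := by
  refine (hc σ u ⟨hu0, hu1⟩).trans ?_
  rw [EReal.coe_add, EReal.coe_mul, EReal.coe_mul]
  gcongr

/-- A first-order estimate along a geodesic, valid near its start, extends to its end. -/
lemma GConvexFn.le_of_local {h : X → EReal} (hc : GConvexFn h) (σ : Geodesic X) (hl : 0 < σ.l)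
    {a v c B τ₀ : ℝ} (hτ₀ : 0 < τ₀) (ha : h (σ.map 0) ≤ a) (hv : h (σ.map σ.l) ≤ v)
    (hloc : ∀ τ, 0 < τ → τ ≤ τ₀ → τ ≤ σ.l → ∀ u : ℝ, h (σ.map τ) ≤ u →
      a ≤ u + c * τ + B * τ ^ 2) : a ≤ v + c * σ.l := by
  have key : ∀ τ, 0 < τ → τ ≤ τ₀ → τ ≤ σ.l → 0 ≤ (v - a) + c * σ.l + B * σ.l * τ := by
    intro τ h0 h1 h2
    have h3 := hc.le_of_le σ ha hv (u := τ / σ.l) (by positivity) ((div_le_one hl).2 h2)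
    rw [div_mul_cancel₀ _ hl.ne'] at h3
    have h4 := hloc τ h0 h1 h2 _ h3
    have h5 : 0 ≤ τ / σ.l * ((v - a) + c * σ.l + B * σ.l * τ) := by
      have : τ / σ.l * ((v - a) + c * σ.l + B * σ.l * τ) =
        τ / σ.l * (v - a) + c * τ + B * τ ^ 2 := by
        field_simp
      rw [this]
      linarith
    exact nonneg_of_mul_nonneg_right h5 (by positivity)
  have hlim : Filter.Tendsto (fun τ : ℝ => (v - a) + c * σ.l + B * σ.l * τ)
      (nhdsWithin 0 (Set.Ioi 0)) (nhds ((v - a) + c * σ.l + B * σ.l * 0)) :=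
    (Continuous.tendsto (by fun_prop) 0).mono_left nhdsWithin_le_nhds
  have := ge_of_tendsto hlim (by
    filter_upwards [Ioc_mem_nhdsGT (lt_min hτ₀ hl)] with τ hτ
    exact key τ hτ.1 (hτ.2.trans (min_le_left _ _)) (hτ.2.trans (min_le_right _ _)))
  linarith

/-- First-order optimality: if `y` locally minimizes `h - n cos (k d(·, z))` up to an error of
slope `δ`, then `h` satisfies a global subgradient inequality at `y`, expressed with the endpoint
of any geodesic issuing from `y` through `z`. -/
lemma GConvexFn.subgradient_of_local {k : ℝ} (hk : 0 < k)
    (hd : ∀ p q : X, k * dist p q < π / 2) (hcos : CosComparison k X) (hgeod : GeodesicSpace X)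
    {h : X → EReal} (hc : GConvexFn h) (γ : Geodesic X) (hγ : 0 < γ.l) {m a n δ τ₀ : ℝ}
    (hm : m ∈ Set.Icc 0 γ.l) (hn : 0 ≤ n) (hτ₀ : 0 < τ₀) (ha : h (γ.map 0) ≤ a)
    (hloc : ∀ p, dist (γ.map 0) p ≤ τ₀ → ∀ v : ℝ, h p ≤ v →
      a - n * cos (k * m) ≤ v - n * cos (k * dist p (γ.map m)) + δ * dist (γ.map 0) p
        + dist (γ.map 0) p ^ 2)
    (w : X) (v : ℝ) (hv : h w ≤ v) :
    a + n * sin (k * m) / sin (k * γ.l) * (cos (k * dist w (γ.map γ.l)) - cos (k * γ.l))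
      - δ * dist (γ.map 0) w ≤ v := by
  have hπ := pi_pos
  have hl : k * γ.l < π / 2 := by
    have := hd (γ.map 0) (γ.map γ.l)
    rwa [γ.dist_zero_map ⟨γ.l_nonneg, le_rfl⟩] at this
  have hs : 0 < sin (k * γ.l) := sin_pos_of_pos_of_lt_pi (mul_pos hk hγ) (by linarith)
  have hkm : k * m ≤ k * γ.l := mul_le_mul_of_nonneg_left hm.2 hk.le
  have hsm : 0 ≤ sin (k * m) :=
    sin_nonneg_of_nonneg_of_le_pi (mul_nonneg hk.le hm.1) (by linarith)
  have hslm : 0 ≤ sin (k * (γ.l - m)) :=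
    sin_nonneg_of_nonneg_of_le_pi (mul_nonneg hk.le (by linarith [hm.2])) (by nlinarith [hm.1])
  obtain ⟨σ, hσ0, hσl, hσ1⟩ := hgeod (γ.map 0) w
  rw [← hσl]
  rcases eq_or_lt_of_le σ.l_nonneg with hl0 | hl0
  · have hw : w = γ.map 0 := by rw [← hσ0, ← hσ1, ← hl0]
    subst hw
    have := hloc (γ.map 0) (by simpa using hτ₀.le) v hv
    rw [γ.dist_zero_map ⟨γ.l_nonneg, le_rfl⟩, ← hl0]
    rw [γ.dist_zero_map hm] at this
    simp only [dist_self] at this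
    linarith
  set r := n * sin (k * m) / sin (k * γ.l) with hr
  set C := cos (k * dist w (γ.map γ.l)) - cos (k * γ.l) with hC
  have main := hc.le_of_local σ hl0 (a := a) (v := v) (c := δ - r * C / σ.l)
    (B := 1 + n * k ^ 2 / 2 * (sin (k * (γ.l - m)) / sin (k * γ.l))) hτ₀ (by rwa [hσ0])
    (by rwa [hσ1]) ?_
  · rw [sub_mul, div_mul_cancel₀ _ hl0.ne'] at main
    linarith
  intro τ h0 h1 h2 u hu
  have hdist : dist (γ.map 0) (σ.map τ) = τ := by rw [← hσ0, σ.dist_zero_map ⟨h0.le, h2⟩]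
  have e1 := hloc (σ.map τ) (by rwa [hdist]) u hu
  rw [hdist] at e1
  have e2 := hcos (σ.map τ) γ m hm
  rw [dist_comm (σ.map τ) (γ.map 0), hdist] at e2
  have e3 := hcos.concave hk hd (γ.map γ.l) σ (u := τ / σ.l) (by positivity)
    ((div_le_one hl0).2 h2)
  rw [div_mul_cancel₀ _ hl0.ne', hσ0, hσ1, dist_comm (γ.map γ.l), dist_comm (γ.map γ.l),
    dist_comm (γ.map γ.l), γ.dist_zero_map ⟨γ.l_nonneg, le_rfl⟩] at e3
  have e4 : 1 - (k * τ) ^ 2 / 2 ≤ cos (k * τ) := one_sub_sq_div_two_le_cos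
  have e5 : cos (k * m) * sin (k * γ.l) = sin (k * (γ.l - m)) + cos (k * γ.l) * sin (k * m) := by
    rw [mul_sub, sin_sub]
    have := sin_sq_add_cos_sq (k * m)
    ring
  have e6 : n * (cos (k * m) - cos (k * dist (σ.map τ) (γ.map m))) ≤
      n * k ^ 2 / 2 * (sin (k * (γ.l - m)) / sin (k * γ.l)) * τ ^ 2 - r * C / σ.l * τ := by
    have : n * k ^ 2 / 2 * (sin (k * (γ.l - m)) / sin (k * γ.l)) * τ ^ 2 - r * C / σ.l * τ =
      n * (((k * τ) ^ 2 / 2 * sin (k * (γ.l - m)) - τ / σ.l * C * sin (k * m)) /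
        sin (k * γ.l)) := by
      rw [hr]
      field_simp
    rw [this]
    refine mul_le_mul_of_nonneg_left ?_ hn
    rw [le_div_iff₀ hs, sub_mul, e5]
    nlinarith [mul_le_mul_of_nonneg_right e4 hslm, mul_le_mul_of_nonneg_right e3 hsm]
  linarith

lemma lowerSemicontinuous_of_isComplete_sublevel {h : X → EReal} (hbot : ∀ y, h y ≠ ⊥)
    (hc : ∀ a : ℝ, IsComplete {y : X | h y ≤ (a : EReal)}) : LowerSemicontinuous h := by
  rw [lowerSemicontinuous_iff_isClosed_preimage]
  intro a
  induction a with
  | bot =>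
    convert isClosed_empty
    ext y
    simpa using hbot y
  | top =>
    convert isClosed_univ
    ext y
    simp
  | coe a => exact (hc a).isClosed

/-- Minimizers of a penalized sum of two functions, with the variables decoupled, concentrate at a
minimum point of the sum. -/
lemma exists_penalized_min {k : ℝ} (hk : 0 < k) (hd : ∀ p q : X, k * dist p q < π / 2)
    {f g : X → EReal} (hfbot : ∀ y, f y ≠ ⊥) (hgbot : ∀ y, g y ≠ ⊥)
    (hf : LowerSemicontinuous f) (hg : LowerSemicontinuous g) {x : X} (hxf : f x ≠ ⊤)
    (hxg : g x ≠ ⊤) (hmin : ∀ y : X, f x + g x ≤ f y + g y) {K : Set X} (hK : IsCompact K)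
    (hxK : x ∈ K) {ε : ℝ} (hε : 0 < ε) :
    ∃ (n : ℝ) (y z : X) (a b : ℝ), 0 ≤ n ∧ dist x y < ε ∧ dist x z < ε ∧ f y = a ∧ g z = b ∧
      ∀ p ∈ K, ∀ q ∈ K, ∀ u v : ℝ, f p ≤ u → g q ≤ v →
        a + b - n * cos (k * dist y z) + dist x y ^ 2 ≤
          u + v - n * cos (k * dist p q) + dist x p ^ 2 := by
  set P : ℕ → X × X → ℝ := fun n q => n * (1 - cos (k * dist q.1 q.2)) + dist x q.1 ^ 2 with hP
  set Φ : ℕ → X × X → EReal := fun n q => f q.1 + g q.2 + (P n q : EReal) with hΦ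
  have hPcont : ∀ n, Continuous (P n) := fun n => by fun_prop
  have hlsc : ∀ n, LowerSemicontinuous (Φ n) := by
    intro n
    refine LowerSemicontinuous.add' (LowerSemicontinuous.add' (hf.comp continuous_fst)
      (hg.comp continuous_snd) fun q => ?_)
      (continuous_coe_real_ereal.comp (hPcont n)).lowerSemicontinuous fun q => ?_
    · exact EReal.continuousAt_add (Or.inr (hgbot _)) (Or.inl (hfbot _))
    · exact EReal.continuousAt_add (Or.inr (EReal.coe_ne_bot _)) (Or.inr (EReal.coe_ne_top _))
  obtain ⟨fx, hfx⟩ : ∃ r : ℝ, f x = r := ⟨_, (EReal.coe_toReal hxf (hfbot x)).symm⟩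
  obtain ⟨gx, hgx⟩ : ∃ r : ℝ, g x = r := ⟨_, (EReal.coe_toReal hxg (hgbot x)).symm⟩
  set T : Set (X × X) := K ×ˢ K ∩ {q | ε ≤ dist x q.1 ∨ ε ≤ dist x q.2} with hT
  have hTc : IsCompact T := by
    refine (hK.prod hK).inter_right ?_
    exact (isClosed_le continuous_const (continuous_const.dist continuous_fst)).union
      (isClosed_le continuous_const (continuous_const.dist continuous_snd))
  have hcos1 : ∀ p q : X, 0 ≤ 1 - cos (k * dist p q) := fun p q => sub_nonneg.2 (cos_le_one _)
  obtain ⟨n, hn⟩ := hTc.elim_directed_cover (fun n => (Φ n) ⁻¹' Set.Ioi (f x + g x))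
    (fun n => (hlsc n).isOpen_preimage _) (by
      rintro ⟨y, z⟩ ⟨-, hyz⟩
      simp only [Set.mem_iUnion, Set.mem_preimage, Set.mem_Ioi]
      by_cases hfy : f y = ⊤
      · exact ⟨0, by
          simp only [hΦ, hfy, EReal.top_add_of_ne_bot (hgbot z), EReal.top_add_coe, hfx, hgx]
          exact EReal.coe_lt_top _⟩
      by_cases hgz : g z = ⊤
      · exact ⟨0, by
          simp only [hΦ, hgz, EReal.add_top_of_ne_bot (hfbot y), EReal.top_add_coe, hfx, hgx]
          exact EReal.coe_lt_top _⟩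
      obtain ⟨a, ha⟩ : ∃ r : ℝ, f y = r := ⟨_, (EReal.coe_toReal hfy (hfbot y)).symm⟩
      obtain ⟨b, hb⟩ : ∃ r : ℝ, g z = r := ⟨_, (EReal.coe_toReal hgz (hgbot z)).symm⟩
      simp only [hΦ, ha, hb, hfx, hgx, ← EReal.coe_add, EReal.coe_lt_coe_iff, hP]
      by_cases hyz' : y = z
      · subst hyz'
        have h1 := hmin y
        rw [ha, hb, hfx, hgx, ← EReal.coe_add, ← EReal.coe_add, EReal.coe_le_coe_iff] at h1
        have h2 : ε ≤ dist x y := by simpa using hyz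
        have h3 : 0 < dist x y ^ 2 := pow_pos (hε.trans_le h2) 2
        exact ⟨0, by simp only [Nat.cast_zero, zero_mul]; linarith⟩
      · have h1 : 0 < k * dist y z := mul_pos hk (dist_pos.2 hyz')
        have h2 : cos (k * dist y z) < 1 := by
          have := strictAntiOn_cos ⟨le_rfl, pi_pos.le⟩
            (⟨h1.le, by linarith [hd y z, pi_pos]⟩ : k * dist y z ∈ Set.Icc 0 π) h1
          simpa using this
        obtain ⟨n, hn⟩ := exists_nat_gt ((fx + gx - a - b) / (1 - cos (k * dist y z)))
        rw [div_lt_iff₀ (sub_pos.2 h2)] at hn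
        exact ⟨n, by nlinarith [sq_nonneg (dist x y)]⟩) (by
      refine directed_of_isDirected_le fun m n hmn q hq => ?_
      refine lt_of_lt_of_le (show f x + g x < Φ m q from hq) ?_
      refine add_le_add le_rfl (EReal.coe_le_coe_iff.2 ?_)
      have : (m : ℝ) ≤ n := by exact_mod_cast hmn
      have := mul_le_mul_of_nonneg_right this (hcos1 q.1 q.2)
      simp only [hP]
      linarith)
  obtain ⟨⟨y, z⟩, hyzK, hyz⟩ := LowerSemicontinuousOn.exists_isMinOn (s := K ×ˢ K) ⟨(x, x), hxK, hxK⟩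
    (hK.prod hK) ((hlsc n).lowerSemicontinuousOn _)
  have hle : Φ n (y, z) ≤ f x + g x := by
    refine (hyz (⟨hxK, hxK⟩ : (x, x) ∈ K ×ˢ K)).trans_eq ?_
    have hP0 : P n (x, x) = 0 := by simp [hP]
    simp [hΦ, hP0]
  have hlt : Φ n (y, z) < ⊤ := hle.trans_lt (by
    rw [hfx, hgx, ← EReal.coe_add]; exact EReal.coe_lt_top _)
  have hnT : (y, z) ∉ T := fun h => (not_lt.2 hle) (hn h)
  have hnear : dist x y < ε ∧ dist x z < ε := by
    by_contra hcon
    refine hnT ⟨hyzK, ?_⟩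
    change ε ≤ dist x y ∨ ε ≤ dist x z
    by_contra! h
    exact hcon h
  have hfy : f y ≠ ⊤ := by
    intro h
    simp [hΦ, h, EReal.top_add_of_ne_bot (hgbot z)] at hlt
  have hgz : g z ≠ ⊤ := by
    intro h
    simp [hΦ, h, EReal.add_top_of_ne_bot (hfbot y)] at hlt
  obtain ⟨a, ha⟩ : ∃ r : ℝ, f y = r := ⟨_, (EReal.coe_toReal hfy (hfbot y)).symm⟩
  obtain ⟨b, hb⟩ : ∃ r : ℝ, g z = r := ⟨_, (EReal.coe_toReal hgz (hgbot z)).symm⟩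
  refine ⟨n, y, z, a, b, n.cast_nonneg, hnear.1, hnear.2, ha, hb, fun p hp q hq u v hu hv => ?_⟩
  have h1 : Φ n (y, z) ≤ Φ n (p, q) := hyz (⟨hp, hq⟩ : (p, q) ∈ K ×ˢ K)
  have h2 : Φ n (p, q) ≤ ((u + v + P n (p, q) : ℝ) : EReal) := by
    rw [EReal.coe_add, EReal.coe_add]
    exact add_le_add (add_le_add hu hv) le_rfl
  have h3 := h1.trans h2
  simp only [hΦ, ha, hb, ← EReal.coe_add, EReal.coe_le_coe_iff, hP] at h3
  linarith

/-- In the setting of geodesic extension, a short segment `[y, z]` extends on both sides to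
segments of length `s` issuing from either endpoint through the other one, the two far ends being
almost `2 s` apart. -/
lemma GeodExtAround.exists_two_sided {x : X} {R : ℝ} (hext : GeodExtAround x R)
    (huniq : UniquelyGeodesic X) {y z : X} {s : ℝ} (hyz : y ≠ z) (hs : dist y z ≤ s)
    (hsR : 2 * s ≤ R) (hy : dist x y < s) (hz : dist x z < s) :
    ∃ γ η : Geodesic X, γ.l = s ∧ η.l = s ∧ γ.map 0 = y ∧ γ.map (dist y z) = z ∧
      η.map 0 = z ∧ η.map (dist y z) = y ∧ dist (γ.map s) (η.map s) = 2 * s - dist y z := by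
  have hm : 0 < dist y z := dist_pos.2 hyz
  have hy' : y ∈ Metric.ball x R := by rw [Metric.mem_ball, dist_comm]; linarith
  have hz' : z ∈ Metric.ball x R := by rw [Metric.mem_ball, dist_comm]; linarith
  obtain ⟨H, hHl, hH0, hH1⟩ := hext z y hz' hy' hyz.symm (by rw [dist_comm]; linarith)
  rw [dist_comm] at hH1
  have hze : dist z (H.map s) = s := by
    rw [← hH0]; exact H.dist_zero_map ⟨by linarith, by linarith⟩
  have hez : dist (H.map s) z = s := by rw [dist_comm, hze]
  have he : H.map s ∈ Metric.ball x R := by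
    rw [Metric.mem_ball, dist_comm]
    linarith [dist_triangle x z (H.map s)]
  obtain ⟨G, hGl, hG0, hG1⟩ := hext (H.map s) z he hz'
    (fun h => by rw [h, dist_self] at hez; linarith) (by linarith)
  rw [hez] at hG1
  have hGy : G.map (s - dist y z) = y := by
    have := huniq (H.map s) z (G.restrict 0 s le_rfl (by linarith) (by linarith))
      (H.restrict 0 s le_rfl (by linarith) (by linarith)).rev
      ⟨by simpa [Geodesic.restrict] using hG0, by simp [Geodesic.restrict, hez],
        by simpa [Geodesic.restrict] using hG1⟩
      ⟨by simp [Geodesic.restrict, Geodesic.rev], by simp [Geodesic.restrict, Geodesic.rev, hez],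
        by simpa [Geodesic.restrict, Geodesic.rev] using hH0⟩
      (s - dist y z) ⟨by linarith, by linarith⟩
    simpa [Geodesic.restrict, Geodesic.rev, hH1] using this
  refine ⟨G.restrict (s - dist y z) (2 * s - dist y z) (by linarith) (by linarith) (by linarith),
    H.restrict 0 s le_rfl (by linarith) (by linarith), ?_, ?_, ?_, ?_, ?_, ?_, ?_⟩
  · simp only [Geodesic.restrict]; ring
  · simp [Geodesic.restrict]
  · simpa [Geodesic.restrict] using hGy
  · simpa [Geodesic.restrict] using hG1
  · simpa [Geodesic.restrict] using hH0
  · simpa [Geodesic.restrict] using hH1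
  · simp only [Geodesic.restrict, zero_add]
    rw [← hG0, dist_comm, G.dist_zero_map ⟨by linarith, by linarith⟩]
    ring

lemma GConvexFn.le_of_local_diag {k : ℝ} (hk : 0 < k)
    (hd : ∀ p q : X, k * dist p q < π / 2) (hcos : CosComparison k X) (hgeod : GeodesicSpace X)
    {h : X → EReal} (hc : GConvexFn h) {y : X} {a n δ τ₀ : ℝ} (hn : 0 ≤ n) (hτ₀ : 0 < τ₀)
    (ha : h y = a)
    (hloc : ∀ p, dist y p ≤ τ₀ → ∀ v : ℝ, h p ≤ v →
      a - n * cos (k * dist y y) ≤ v - n * cos (k * dist p y) + δ * dist y p + dist y p ^ 2)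
    (w : X) (v : ℝ) (hv : h w ≤ v) : a - δ * dist y w ≤ v := by
  obtain ⟨σ, hσ0, hσl, hσ1⟩ := hgeod y w
  rcases eq_or_lt_of_le σ.l_nonneg with hl0 | hl0
  · have hw : w = y := by rw [← hσ0, ← hσ1, ← hl0]
    rw [hw, ha, EReal.coe_le_coe_iff] at hv
    simpa [hw] using hv
  subst hσ0
  have := hc.subgradient_of_local hk hd hcos hgeod σ hl0 (m := 0) ⟨le_rfl, hl0.le⟩ hn hτ₀
    ha.le (by simpa using hloc) w v hv
  simpa using this

/-- Approximate opposite subgradients: either `x` almost minimizes both functions, or there are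
two almost opposite points at distance almost `s` from `x` witnessing approximate subgradient
inequalities with the same slope. -/
lemma exists_approx_subgradients {k : ℝ} (hk : 0 < k) (hd : ∀ p q : X, k * dist p q < π / 2)
    (hcos : CosComparison k X) (hgeod : GeodesicSpace X) (huniq : UniquelyGeodesic X)
    {f g : X → EReal} (hfbot : ∀ y, f y ≠ ⊥) (hgbot : ∀ y, g y ≠ ⊥)
    (hf : LowerSemicontinuous f) (hg : LowerSemicontinuous g)
    (hfconv : GConvexFn f) (hgconv : GConvexFn g) {x : X} {fx gx D s R : ℝ}
    (hfx : f x = fx) (hgx : g x = gx) (hmin : ∀ y : X, f x + g x ≤ f y + g y)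
    (hext : GeodExtAround x R) (hD : ∀ p q : X, dist p q ≤ D) (hs : 0 < s) (hsR : 2 * s ≤ R)
    (hK : IsCompact (Metric.closedBall x (2 * s))) {ε : ℝ} (hε : 0 < ε) (hεs : ε ≤ s / 2) :
    ((∀ (w : X) (v : ℝ), f w ≤ v → fx - ε * (1 + 2 * D) ≤ v) ∧
      (∀ (w : X) (v : ℝ), g w ≤ v → gx - ε * (1 + 2 * D) ≤ v)) ∨
    ∃ (e₁ e₂ : X) (r : ℝ), 0 ≤ r ∧ |dist x e₁ - s| ≤ ε ∧ |dist x e₂ - s| ≤ ε ∧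
      2 * s - 2 * ε ≤ dist e₁ e₂ ∧
      (∀ (w : X) (v : ℝ), f w ≤ v →
        fx - ε * (1 + 2 * D) + r * (cos (k * dist w e₁) - cos (k * s)) ≤ v) ∧
      (∀ (w : X) (v : ℝ), g w ≤ v →
        gx - ε * (1 + 2 * D) + r * (cos (k * dist w e₂) - cos (k * s)) ≤ v) := by
  have hD0 : 0 ≤ D := dist_nonneg.trans (hD x x)
  have hev : ∀ᶠ y in nhds x, ((fx - ε : ℝ) : EReal) < f y ∧ ((gx - ε : ℝ) : EReal) < g y := by
    refine (hf x _ ?_).and (hg x _ ?_)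
    · change ((fx - ε : ℝ) : EReal) < f x
      rw [hfx, EReal.coe_lt_coe_iff]; linarith
    · change ((gx - ε : ℝ) : EReal) < g x
      rw [hgx, EReal.coe_lt_coe_iff]; linarith
  obtain ⟨ε₁, hε₁, hball⟩ := Metric.eventually_nhds_iff.1 hev
  obtain ⟨n, y, z, a, b, hn, hxy, hxz, ha, hb, hpen⟩ :=
    exists_penalized_min hk hd hfbot hgbot hf hg (hfx ▸ EReal.coe_ne_top _)
      (hgx ▸ EReal.coe_ne_top _) hmin hK (Metric.mem_closedBall_self (by linarith))
      (lt_min hε₁ hε)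
  have hxy' := hxy.trans_le (min_le_right _ _)
  have hxz' := hxz.trans_le (min_le_right _ _)
  have hfa : fx - ε < a := by
    have := (hball (y := y) (by rw [dist_comm]; exact hxy.trans_le (min_le_left _ _))).1
    rwa [ha, EReal.coe_lt_coe_iff] at this
  have hgb : gx - ε < b := by
    have := (hball (y := z) (by rw [dist_comm]; exact hxz.trans_le (min_le_left _ _))).2
    rwa [hb, EReal.coe_lt_coe_iff] at this
  have hyK : y ∈ Metric.closedBall x (2 * s) := by
    rw [Metric.mem_closedBall, dist_comm]; linarith
  have hzK : z ∈ Metric.closedBall x (2 * s) := by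
    rw [Metric.mem_closedBall, dist_comm]; linarith
  have hlocf : ∀ p, dist y p ≤ s → ∀ v : ℝ, f p ≤ v →
      a - n * cos (k * dist y z) ≤ v - n * cos (k * dist p z) + (2 * dist x y) * dist y p
        + dist y p ^ 2 := by
    intro p hp v hv
    have htri := dist_triangle x y p
    have h1 := hpen p (by rw [Metric.mem_closedBall, dist_comm]; linarith) z hzK v b hv hb.le
    have h2 : dist x p ^ 2 ≤ (dist x y + dist y p) ^ 2 := by gcongr
    nlinarith
  have hlocg : ∀ q, dist z q ≤ s → ∀ v : ℝ, g q ≤ v →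
      b - n * cos (k * dist z y) ≤ v - n * cos (k * dist q y) + 0 * dist z q
        + dist z q ^ 2 := by
    intro q hq v hv
    have htri := dist_triangle x z q
    have h1 := hpen y hyK q (by rw [Metric.mem_closedBall, dist_comm]; linarith) a v ha.le hv
    rw [dist_comm z y, dist_comm q y]
    nlinarith [sq_nonneg (dist z q)]
  have hδ : ∀ w, 2 * dist x y * dist y w ≤ ε * (2 * D) := fun w => by
    have := mul_le_mul hxy'.le (hD y w) dist_nonneg hε.le
    linarith
  by_cases hyz : y = z
  · left
    subst hyz
    refine ⟨fun w v hv => ?_, fun w v hv => ?_⟩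
    · have := hfconv.le_of_local_diag hk hd hcos hgeod hn hs ha hlocf w v hv
      linarith [hδ w]
    · have := hgconv.le_of_local_diag hk hd hcos hgeod hn hs hb hlocg w v hv
      have := mul_nonneg hε.le hD0
      linarith
  right
  have hyzε : dist y z < 2 * ε := by linarith [dist_triangle_left y z x]
  obtain ⟨γ, η, hγl, hηl, hγ0, hγm, hη0, hηm, hsep⟩ := hext.exists_two_sided huniq hyz
    (s := s) (by linarith) hsR (by linarith) (by linarith)
  subst hγ0 hη0
  have hm : dist (γ.map 0) (η.map 0) ∈ Set.Icc 0 s := ⟨dist_nonneg, by linarith⟩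
  have hks : k * s < π / 2 := by
    have := hd (γ.map 0) (γ.map γ.l)
    rwa [γ.dist_zero_map ⟨γ.l_nonneg, le_rfl⟩, hγl] at this
  have hks0 := mul_pos hk hs
  have hπ := pi_pos
  have hnear : ∀ (σ : Geodesic X), σ.l = s → dist x (σ.map 0) < ε →
      |dist x (σ.map s) - s| ≤ ε := by
    intro σ hσ h0
    have h1 : dist (σ.map 0) (σ.map s) = s := σ.dist_zero_map ⟨hs.le, hσ.ge⟩
    rw [abs_le]
    constructor
    · linarith [dist_triangle_left (σ.map 0) (σ.map s) x]
    · linarith [dist_triangle x (σ.map 0) (σ.map s)]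
  refine ⟨γ.map s, η.map s, n * sin (k * dist (γ.map 0) (η.map 0)) / sin (k * s), ?_,
    hnear γ hγl hxy', hnear η hηl hxz', by linarith, fun w v hv => ?_, fun w v hv => ?_⟩
  · refine div_nonneg (mul_nonneg hn ?_) ?_
    · exact sin_nonneg_of_nonneg_of_le_pi (mul_nonneg hk.le hm.1) (by nlinarith [hm.2])
    · exact sin_nonneg_of_nonneg_of_le_pi hks0.le (by linarith)
  · have := hfconv.subgradient_of_local hk hd hcos hgeod γ (by linarith)
      (m := dist (γ.map 0) (η.map 0)) (by rwa [hγl]) hn hs ha.le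
      (by rw [hγm]; exact hlocf) w v hv
    rw [hγl] at this
    linarith [hδ w]
  · have := hgconv.subgradient_of_local hk hd hcos hgeod η (by linarith)
      (m := dist (γ.map 0) (η.map 0)) (by rwa [hηl]) hn hs hb.le
      (by rw [hηm, dist_comm (γ.map 0)]; exact hlocg) w v hv
    rw [hηl] at this
    have := mul_nonneg hε.le hD0
    linarith

/-- Opposite subgradients in cosine form, before extending the directions to geodesics. -/
lemma exists_opposite_cos_subgradients {k : ℝ} (hk : 0 < k)
    (hd : ∀ p q : X, k * dist p q < π / 2)
    (hcos : CosComparison k X) (hgeod : GeodesicSpace X) (huniq : UniquelyGeodesic X)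
    {f g : X → EReal} (hfbot : ∀ y, f y ≠ ⊥) (hgbot : ∀ y, g y ≠ ⊥)
    (hf : LowerSemicontinuous f) (hg : LowerSemicontinuous g)
    (hfconv : GConvexFn f) (hgconv : GConvexFn g) {x : X} {fx gx D s R : ℝ}
    (hfx : f x = fx) (hgx : g x = gx) (hmin : ∀ y : X, f x + g x ≤ f y + g y)
    (hext : GeodExtAround x R) (hD : ∀ p q : X, dist p q ≤ D) (hs : 0 < s) (hsR : 2 * s ≤ R)
    (hK : IsCompact (Metric.closedBall x (2 * s)))
    (hbdd : ∀ y ∈ Metric.closedBall x (2 * s), f y ≤ ((fx + 1 : ℝ) : EReal)) :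
    ((∀ (w : X) (v : ℝ), f w ≤ v → fx ≤ v) ∧ (∀ (w : X) (v : ℝ), g w ≤ v → gx ≤ v)) ∨
    ∃ (e₁ e₂ : X) (r : ℝ), 0 ≤ r ∧ dist x e₁ = s ∧ dist x e₂ = s ∧ 2 * s ≤ dist e₁ e₂ ∧
      (∀ (w : X) (v : ℝ), f w ≤ v → fx + r * (cos (k * dist w e₁) - cos (k * s)) ≤ v) ∧
      (∀ (w : X) (v : ℝ), g w ≤ v → gx + r * (cos (k * dist w e₂) - cos (k * s)) ≤ v) := by
  have hD0 : 0 ≤ D := dist_nonneg.trans (hD x x)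
  by_cases hQ : ∀ ε > 0, (∀ (w : X) (v : ℝ), f w ≤ v → fx - ε * (1 + 2 * D) ≤ v) ∧
      (∀ (w : X) (v : ℝ), g w ≤ v → gx - ε * (1 + 2 * D) ≤ v)
  · left
    have key : ∀ c v : ℝ, (∀ ε > 0, c - ε * (1 + 2 * D) ≤ v) → c ≤ v := by
      intro c v h
      refine le_of_forall_pos_le_add fun ε hε => ?_
      have h1 := h (ε / (1 + 2 * D)) (by positivity)
      rw [div_mul_cancel₀ _ (by positivity)] at h1
      linarith
    exact ⟨fun w v hv => key _ _ fun ε hε => (hQ ε hε).1 w v hv,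
      fun w v hv => key _ _ fun ε hε => (hQ ε hε).2 w v hv⟩
  right
  push Not at hQ
  obtain ⟨ε₀, hε₀, hnQ⟩ := hQ
  set ε : ℕ → ℝ := fun m => min (min ε₀ (s / 2)) (1 / (m + 1)) with hεdef
  have hεpos : ∀ m, 0 < ε m := fun m => lt_min (lt_min hε₀ (by linarith)) (by positivity)
  have hε0 : ∀ m, ε m ≤ ε₀ := fun m => (min_le_left _ _).trans (min_le_left _ _)
  have hεs : ∀ m, ε m ≤ s / 2 := fun m => (min_le_left _ _).trans (min_le_right _ _)
  have hεlim : Filter.Tendsto ε Filter.atTop (nhds 0) :=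
    squeeze_zero (fun m => (hεpos m).le) (fun m => min_le_right _ _)
      tendsto_one_div_add_atTop_nhds_zero_nat
  have hP := fun m => (exists_approx_subgradients hk hd hcos hgeod huniq hfbot hgbot hf hg hfconv
    hgconv hfx hgx hmin hext hD hs hsR hK (hεpos m) (hεs m)).resolve_left (by
      rintro ⟨h1, h2⟩
      have hmono := mul_le_mul_of_nonneg_right (hε0 m) (by positivity : 0 ≤ 1 + 2 * D)
      obtain ⟨w, v, hv, hlt⟩ := hnQ fun w v hv => by linarith [h1 w v hv]
      linarith [h2 w v hv])
  choose e₁ e₂ r hr hd₁ hd₂ hsep hsf hsg using hP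
  have hks : k * s < π / 2 := by
    have h1 := hd x (e₁ 0)
    have h2 := hd (e₁ 0) (e₂ 0)
    have h3 := hsep 0
    have h4 := hεs 0
    have h5 := mul_le_mul_of_nonneg_left (show s ≤ dist (e₁ 0) (e₂ 0) by linarith) hk.le
    linarith
  have hks0 := mul_pos hk hs
  have hπ := pi_pos
  have hcs : 0 < 1 - cos (k * s) := by
    have := strictAntiOn_cos ⟨le_rfl, hπ.le⟩ (⟨hks0.le, by linarith⟩ : k * s ∈ Set.Icc 0 π) hks0
    rw [cos_zero] at this
    linarith
  have hmem : ∀ (p : X) (m : ℕ), |dist x p - s| ≤ ε m → p ∈ Metric.closedBall x (2 * s) := by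
    intro p m h
    rw [Metric.mem_closedBall, dist_comm]
    linarith [(abs_le.1 h).2, hεs m]
  set C := (1 + ε₀ * (1 + 2 * D)) / (1 - cos (k * s)) with hC
  have hrC : ∀ m, r m ∈ Set.Icc 0 C := by
    refine fun m => ⟨hr m, ?_⟩
    have h1 := hsf m (e₁ m) _ (hbdd _ (hmem _ m (hd₁ m)))
    rw [dist_self, mul_zero, cos_zero] at h1
    rw [hC, le_div_iff₀ hcs]
    have hmono := mul_le_mul_of_nonneg_right (hε0 m) (by positivity : 0 ≤ 1 + 2 * D)
    linarith
  obtain ⟨⟨e, e', r'⟩, -, φ, hφ, hlim⟩ := (hK.prod (hK.prod isCompact_Icc)).tendsto_subseq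
    (x := fun m => (e₁ m, e₂ m, r m))
    (fun m => ⟨hmem _ m (hd₁ m), hmem _ m (hd₂ m), hrC m⟩)
  have he₁ : Filter.Tendsto (fun m => e₁ (φ m)) Filter.atTop (nhds e) :=
    (continuous_fst.tendsto _).comp hlim
  have he₂ : Filter.Tendsto (fun m => e₂ (φ m)) Filter.atTop (nhds e') :=
    ((continuous_fst.comp continuous_snd).tendsto _).comp hlim
  have hr' : Filter.Tendsto (fun m => r (φ m)) Filter.atTop (nhds r') :=
    ((continuous_snd.comp continuous_snd).tendsto _).comp hlim
  have hεφ : Filter.Tendsto (fun m => ε (φ m)) Filter.atTop (nhds 0) :=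
    hεlim.comp hφ.tendsto_atTop
  have hdist : ∀ {u : ℕ → X} {p : X}, Filter.Tendsto (fun m => u (φ m)) Filter.atTop (nhds p) →
      (∀ m, |dist x (u m) - s| ≤ ε m) → dist x p = s := by
    intro u p hu h
    have h1 : Filter.Tendsto (fun m => |dist x (u (φ m)) - s|) Filter.atTop
        (nhds |dist x p - s|) := ((tendsto_const_nhds.dist hu).sub_const s).abs
    have h2 := le_of_tendsto_of_tendsto' h1 hεφ fun m => h (φ m)
    linarith [abs_eq_zero.1 (le_antisymm h2 (abs_nonneg _))]
  have hsub : ∀ {u : ℕ → X} {p : X} {c : ℝ} {h : X → EReal},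
      Filter.Tendsto (fun m => u (φ m)) Filter.atTop (nhds p) →
      (∀ m (w : X) (v : ℝ), h w ≤ v →
        c - ε m * (1 + 2 * D) + r m * (cos (k * dist w (u m)) - cos (k * s)) ≤ v) →
      ∀ (w : X) (v : ℝ), h w ≤ v → c + r' * (cos (k * dist w p) - cos (k * s)) ≤ v := by
    intro u p c h hu hyp w v hv
    have h1 : Filter.Tendsto (fun m => c - ε (φ m) * (1 + 2 * D) +
        r (φ m) * (cos (k * dist w (u (φ m))) - cos (k * s))) Filter.atTop
        (nhds (c - 0 * (1 + 2 * D) + r' * (cos (k * dist w p) - cos (k * s)))) := by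
      refine (tendsto_const_nhds.sub (hεφ.mul_const _)).add (hr'.mul ?_)
      exact ((continuous_cos.tendsto _).comp
        ((tendsto_const_nhds.dist hu).const_mul k)).sub_const _
    have h2 := le_of_tendsto' h1 fun m => hyp (φ m) w v hv
    linarith
  refine ⟨e, e', r', ge_of_tendsto' hr' fun m => hr _, hdist he₁ hd₁, hdist he₂ hd₂, ?_,
    hsub he₁ hsf, hsub he₂ hsg⟩
  have h1 : Filter.Tendsto (fun m => 2 * s - 2 * ε (φ m)) Filter.atTop
      (nhds (2 * s - 2 * 0)) := tendsto_const_nhds.sub (hεφ.const_mul 2)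
  have h2 := le_of_tendsto_of_tendsto' h1 (he₁.dist he₂) fun m => hsep (φ m)
  linarith

lemma mul_sq_sub_sq_le_cos_sub_cos {θ δ : ℝ} (hθ : 0 < θ) (hθ' : θ ≤ π) (hδ : 0 ≤ δ)
    (hδ' : δ ≤ π) : sin θ * ((θ ^ 2 - δ ^ 2) / (2 * θ)) ≤ cos δ - cos θ := by
  set F : ℝ → ℝ := fun u => cos u + sin θ / (2 * θ) * u ^ 2 with hF
  have hder : ∀ u, HasDerivAt F (-sin u + sin θ / θ * u) u := fun u => by
    refine ((hasDerivAt_cos u).add (((hasDerivAt_pow 2 u).const_mul _))).congr_deriv ?_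
    field_simp
    norm_num
    ring
  have hcont : Continuous F := by fun_prop
  have hratio : ∀ a b : ℝ, 0 ≤ a → a ≤ b → 0 < b → b ≤ π → sin b / b * a ≤ sin a := by
    intro a b ha hab hb hb'
    have := mul_sin_le_sin_mul (div_nonneg ha hb.le) ((div_le_one hb).2 hab) hb.le hb'
    rw [div_mul_cancel₀ _ hb.ne'] at this
    exact (by ring : sin b / b * a = a / b * sin b).trans_le this
  have hle : F θ ≤ F δ := by
    rcases le_total δ θ with h | h
    · have hanti : AntitoneOn F (Set.Icc 0 θ) := by
        refine antitoneOn_of_deriv_nonpos (convex_Icc _ _) hcont.continuousOn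
          (fun u _ => (hder u).differentiableAt.differentiableWithinAt) fun u hu => ?_
        rw [interior_Icc] at hu
        rw [(hder u).deriv]
        linarith [hratio u θ hu.1.le hu.2.le hθ hθ']
      exact hanti ⟨hδ, h⟩ ⟨hθ.le, le_rfl⟩ h
    · have hmono : MonotoneOn F (Set.Icc θ π) := by
        refine monotoneOn_of_deriv_nonneg (convex_Icc _ _) hcont.continuousOn
          (fun u _ => (hder u).differentiableAt.differentiableWithinAt) fun u hu => ?_
        rw [interior_Icc] at hu
        have hu0 : 0 < u := hθ.trans hu.1
        rw [(hder u).deriv]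
        have h1 := hratio θ u hθ.le hu.1.le hu0 hu.2.le
        rw [div_mul_eq_mul_div, div_le_iff₀ hu0] at h1
        have h2 : sin u ≤ sin θ / θ * u := by
          rw [div_mul_eq_mul_div, le_div_iff₀ hθ]
          exact h1
        linarith
      exact hmono ⟨le_rfl, hθ'⟩ ⟨h, hδ'⟩ h
  have : sin θ * ((θ ^ 2 - δ ^ 2) / (2 * θ)) =
      sin θ / (2 * θ) * θ ^ 2 - sin θ / (2 * θ) * δ ^ 2 := by ring
  simp only [hF] at hle
  linarith

lemma dist_toXR (p q : X) (a b : ℝ) :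
    dist (toXR p a) (toXR q b) = √(dist p q ^ 2 + (a - b) ^ 2) := by
  rw [WithLp.prod_dist_eq_add (by norm_num), Real.sqrt_eq_rpow]
  have h : dist a b ^ 2 = (a - b) ^ 2 := by rw [Real.dist_eq, sq_abs]
  simp [toXR, h]

lemma isSubgrad_zero {h : X → EReal} {x : X} {R₀ hx : ℝ} (hR : 0 < R₀) (hhx : h x = hx)
    (hmin : ∀ (w : X) (v : ℝ), h w ≤ v → hx ≤ v) : IsSubgrad R₀ h x (constGeod x) 0 := by
  refine ⟨⟨R₀, hR.le, fun t => toXR x (hx - t), ?_⟩, rfl, fun t => ?_, Or.inr ⟨R₀, hR, le_rfl, ?_⟩⟩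
  · intro s _ t _
    rw [dist_toXR, dist_self, show hx - s - (hx - t) = -(s - t) by ring]
    simp [Real.sqrt_sq_eq_abs, abs_sub_comm]
  · simp [constGeod, hhx]
  simp only [hhx, EReal.toReal_coe]
  have hx0 : dist (toXR x (hx - R₀)) (toXR x hx) = R₀ := by
    rw [dist_toXR, dist_self, show hx - R₀ - hx = -R₀ by ring]
    simp [Real.sqrt_sq_eq_abs, abs_of_pos hR]
  have hmem : toXR x hx ∈ epigraph h := by simp [epigraph, toXR, hhx]
  refine Set.Subset.antisymm (fun c hc => ?_) (Set.singleton_subset_iff.2 ⟨hmem, fun c hc => ?_⟩)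
  · have h1 := hc.2 _ hmem
    rw [hx0] at h1
    have h2 : h c.fst ≤ (c.snd : ℝ) := hc.1
    have h3 := hmin _ _ h2
    change dist (toXR x (hx - R₀)) (toXR c.fst c.snd) ≤ R₀ at h1
    rw [dist_toXR, Real.sqrt_le_left hR.le] at h1
    have h4 : c.snd = hx := by nlinarith [sq_nonneg (dist x c.fst)]
    have h5 : dist x c.fst = 0 := by
      rw [h4] at h1
      nlinarith [dist_nonneg (x := x) (y := c.fst)]
    change toXR c.fst c.snd = toXR x hx
    rw [h4, ← dist_eq_zero.1 h5]
  · have h3 := hmin c.fst c.snd hc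
    rw [hx0]
    change R₀ ≤ dist (toXR x (hx - R₀)) (toXR c.fst c.snd)
    rw [dist_toXR]
    apply Real.le_sqrt_of_sq_le
    nlinarith [sq_nonneg (dist x c.fst)]

/-- A quadratic subgradient inequality at a point of a geodesic yields a subgradient. -/
lemma GConvexFn.isSubgrad_of_quadratic {k : ℝ} (hk : 0 < k)
    (hd : ∀ p q : X, k * dist p q < π / 2) (hcos : CosComparison k X) (hgeod : GeodesicSpace X)
    {h : X → EReal} (hc : GConvexFn h) {γ : Geodesic X} {r s₀ hx : ℝ} (hr : 0 < r)
    (hs₀ : 0 < s₀) (hs₀l : s₀ ≤ γ.l) (hhx : h (γ.map 0) = hx)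
    (hsub : ∀ (w : X) (v : ℝ), h w ≤ v →
      hx + r * ((s₀ ^ 2 - dist w (γ.map s₀) ^ 2) / (2 * s₀)) ≤ v) :
    IsSubgrad γ.l h (γ.map 0) γ r := by
  have hl : 0 < γ.l := hs₀.trans_le hs₀l
  set N := √(r ^ 2 + 1) with hN
  have hN0 : 0 < N := Real.sqrt_pos.2 (by positivity)
  have hNsq : N ^ 2 = r ^ 2 + 1 := Real.sq_sqrt (by positivity)
  have hrN : r ≤ N := by nlinarith
  have hmem : ∀ t ∈ Set.Icc 0 γ.l, r * t / N ∈ Set.Icc 0 γ.l := by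
    rintro t ⟨h0, h1⟩
    refine ⟨by positivity, (div_le_iff₀ hN0).2 ?_⟩
    rw [mul_comm γ.l]
    exact mul_le_mul hrN h1 h0 hN0.le
  set s := min s₀ (r * γ.l / N) with hs
  have hs0 : 0 < s := lt_min hs₀ (by positivity)
  have hss₀ : s ≤ s₀ := min_le_left _ _
  have hsl : s ≤ γ.l := hss₀.trans hs₀l
  have hquad : ∀ (w : X) (v : ℝ), h w ≤ v →
      hx + r * ((s ^ 2 - dist (γ.map s) w ^ 2) / (2 * s)) ≤ v := by
    intro w v hv
    refine le_trans ?_ (hsub w v hv)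
    gcongr hx + r * ?_
    have h1 := dist_triangle w (γ.map s) (γ.map s₀)
    rw [γ.dist_map_of_le hs0.le hss₀ hs₀l, dist_comm w (γ.map s)] at h1
    have h2 : dist w (γ.map s₀) ^ 2 ≤ (dist (γ.map s) w + (s₀ - s)) ^ 2 := by gcongr
    rw [div_le_div_iff₀ (by positivity) (by positivity)]
    nlinarith [mul_le_mul_of_nonneg_left h2 hs0.le,
      mul_nonneg (sub_nonneg.2 hss₀) (sq_nonneg (dist (γ.map s) w - s))]
  set t := s * N / r with ht
  have ht0 : 0 < t := by positivity
  have htl : t ≤ γ.l := by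
    rw [ht, div_le_iff₀ hr, ← le_div_iff₀ hN0, mul_comm γ.l]
    exact min_le_right _ _
  have hts : r * t / N = s := by rw [ht]; field_simp
  have htN : t / N = s / r := by rw [ht]; field_simp
  have htsq : t ^ 2 = s ^ 2 + (s / r) ^ 2 := by
    rw [ht, div_pow, mul_pow, hNsq]
    field_simp
  refine ⟨⟨γ.l, hl.le, fun t => toXR (γ.map (r * t / N)) (hx - t / N), ?_⟩, rfl, fun t => ?_,
    Or.inr ⟨t, ht0, htl, ?_⟩⟩
  · intro a ha b hb
    rw [dist_toXR, γ.isom _ (hmem a ha) _ (hmem b hb), sq_abs, ← Real.sqrt_sq_eq_abs]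
    congr 1
    field_simp
    rw [hNsq]
    ring
  · simp [hhx, hN]
  simp only [hhx, EReal.toReal_coe, hts, htN]
  have hdx : dist (γ.map s) (γ.map 0) = s := by
    rw [dist_comm, γ.dist_zero_map ⟨hs0.le, hsl⟩]
  have hx0 : dist (toXR (γ.map s) (hx - s / r)) (toXR (γ.map 0) hx) = t := by
    rw [dist_toXR, hdx, show hx - s / r - hx = -(s / r) by ring, neg_sq, ← htsq,
      Real.sqrt_sq ht0.le]
  have hmem : toXR (γ.map 0) hx ∈ epigraph h := by simp [epigraph, toXR, hhx]
  have hlow : ∀ (w : X) (v : ℝ), h w ≤ v → t ^ 2 + (v - hx) ^ 2 ≤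
      dist (γ.map s) w ^ 2 + (hx - s / r - v) ^ 2 := by
    intro w v hv
    have h1 := hquad w v hv
    have h2 : s ^ 2 - dist (γ.map s) w ^ 2 ≤ 2 * (s / r) * (v - hx) := by
      have h3 : 2 * (s / r) * (r * ((s ^ 2 - dist (γ.map s) w ^ 2) / (2 * s))) =
          s ^ 2 - dist (γ.map s) w ^ 2 := by field_simp
      rw [← h3]
      exact mul_le_mul_of_nonneg_left (by linarith) (by positivity)
    rw [htsq]
    linarith
  refine Set.Subset.antisymm (fun c hc' => ?_) (Set.singleton_subset_iff.2 ⟨hmem, fun c hc' => ?_⟩)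
  · have h1 := hc'.2 _ hmem
    rw [hx0] at h1
    have h2 : h c.fst ≤ (c.snd : ℝ) := hc'.1
    change dist (toXR (γ.map s) (hx - s / r)) (toXR c.fst c.snd) ≤ t at h1
    rw [dist_toXR, Real.sqrt_le_left ht0.le] at h1
    have h3 := hlow _ _ h2
    have h4 : c.snd = hx := by nlinarith [sq_nonneg (c.snd - hx)]
    rw [h4, htsq, show hx - s / r - hx = -(s / r) by ring, neg_sq] at h1
    rw [h4] at h2
    have h5 : dist (γ.map s) c.fst ≤ s := by
      refine le_of_sq_le_sq (by linarith) hs0.le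
    have h6 : dist (γ.map s) c.fst = s := by
      refine le_antisymm h5 ?_
      have h7 := hquad _ _ h2
      by_contra! hlt
      have : 0 < r * ((s ^ 2 - dist (γ.map s) c.fst ^ 2) / (2 * s)) := by
        have : dist (γ.map s) c.fst ^ 2 < s ^ 2 := by gcongr
        have := sub_pos.2 this
        positivity
      linarith
    have h8 : c.fst = γ.map 0 := by
      obtain ⟨σ, hσ0, hσl, hσ1⟩ := hgeod (γ.map 0) c.fst
      rcases eq_or_lt_of_le σ.l_nonneg with hl0 | hl0
      · rw [← hσ0, ← hσ1, ← hl0]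
      exfalso
      have h9 := hcos.dist_midpoint_lt hk hd (γ.map s) σ hl0 (by rw [hσ0, hσ1, h6, hdx])
      rw [hσ0, hdx] at h9
      have h10 := hc.le_of_le σ (a := hx) (b := hx) (u := 1 / 2) (by rw [hσ0, hhx])
        (by rwa [hσ1]) (by norm_num) (by norm_num)
      have h11 := hquad _ _ h10
      have : 0 < r * ((s ^ 2 - dist (γ.map s) (σ.map (1 / 2 * σ.l)) ^ 2) / (2 * s)) := by
        have : dist (γ.map s) (σ.map (1 / 2 * σ.l)) ^ 2 < s ^ 2 := by gcongr
        have := sub_pos.2 this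
        positivity
      linarith
    change toXR c.fst c.snd = toXR (γ.map 0) hx
    rw [h4, h8]
  · rw [hx0]
    change t ≤ dist (toXR (γ.map s) (hx - s / r)) (toXR c.fst c.snd)
    rw [dist_toXR]
    apply Real.le_sqrt_of_sq_le
    linarith [hlow c.fst c.snd hc', sq_nonneg (c.snd - hx)]

lemma alexAngle_eq_pi {γ η : Geodesic X} {s : ℝ} (hs : 0 < s) (hγ : s ≤ γ.l) (hη : s ≤ η.l)
    (h0 : γ.map 0 = η.map 0) (hsep : 2 * s ≤ dist (γ.map s) (η.map s)) :
    alexAngle γ η = π := by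
  refine Filter.Tendsto.limUnder_eq (tendsto_const_nhds.congr' ?_)
  have hev := Ioc_mem_nhdsGT hs
  filter_upwards [Filter.prod_mem_prod hev hev] with p hp
  obtain ⟨⟨hp1, hp1'⟩, hp2, hp2'⟩ := hp
  have e1 : dist (γ.map 0) (γ.map p.1) = p.1 := γ.dist_zero_map ⟨hp1.le, hp1'.trans hγ⟩
  have e2 : dist (γ.map 0) (η.map p.2) = p.2 := by
    rw [h0]; exact η.dist_zero_map ⟨hp2.le, hp2'.trans hη⟩
  have e3 : dist (γ.map p.1) (η.map p.2) = p.1 + p.2 := by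
    have t1 := dist_triangle_left (γ.map p.1) (η.map p.2) (γ.map 0)
    have t2 := dist_triangle4 (γ.map s) (γ.map p.1) (η.map p.2) (η.map s)
    have t3 := γ.dist_map_of_le hp1.le hp1' hγ
    have t4 := η.dist_map_of_le hp2.le hp2' hη
    rw [dist_comm (γ.map s) (γ.map p.1)] at t2
    linarith
  rw [compAngle, e1, e2, e3, show (p.1 ^ 2 + p.2 ^ 2 - (p.1 + p.2) ^ 2) / (2 * p.1 * p.2) = -1 by
    have := hp1.ne'
    have := hp2.ne'
    field_simp
    ring, arccos_neg_one]
end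

/-- Theorem 4.20 (sum rule): if `f, g` are convex with complete sublevel sets on a space
of diameter `< D_κ/2`, `x ∈ dom f ∩ dom g` minimizes `f + g`, and `f` is continuous at
`x`, then there exist `([γ],r) ∈ ∂f(x)` and `([η],s) ∈ ∂g(x)` opposite to each other. -/
theorem statement18 {X : Type*} [MetricSpace X] {κ : ℝ} {R : X → ℝ} (hX : Standing κ X R)
    (hdiam : ∃ D : ℝ, D < Dk κ / 2 ∧ ∀ p q : X, dist p q ≤ D)
    (f g : X → EReal) (hfbot : ∀ y, f y ≠ ⊥) (hgbot : ∀ y, g y ≠ ⊥)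
    (hfconv : GConvexFn f) (hgconv : GConvexFn g)
    (hfcompl : ∀ a : ℝ, IsComplete {y : X | f y ≤ (a : EReal)})
    (hgcompl : ∀ a : ℝ, IsComplete {y : X | g y ≤ (a : EReal)})
    (x : X) (hxf : f x < ⊤) (hxg : g x < ⊤)
    (hmin : ∀ y : X, f x + g x ≤ f y + g y)
    (hcont : ContinuousAt f x) :
    ∃ (γ : Geodesic X) (r : ℝ) (η : Geodesic X) (s : ℝ),
      InTangent x γ r ∧ InTangent x η s ∧
      IsSubgrad (R x) f x γ r ∧ IsSubgrad (R x) g x η s ∧ TanOpposite γ r η s := by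
  obtain ⟨D, hDlt, hD⟩ := hdiam
  have hk : 0 < √κ := Real.sqrt_pos.2 hX.kpos
  have hd : ∀ p q : X, √κ * dist p q < π / 2 := by
    intro p q
    have h1 := (hD p q).trans_lt hDlt
    rw [Dk, div_right_comm, lt_div_iff₀ hk] at h1
    linarith
  have hcos := hX.cat.cosComparison hX.kpos hd
  obtain ⟨fx, hfx⟩ : ∃ r : ℝ, f x = r := ⟨_, (EReal.coe_toReal hxf.ne (hfbot x)).symm⟩
  obtain ⟨gx, hgx⟩ : ∃ r : ℝ, g x = r := ⟨_, (EReal.coe_toReal hxg.ne (hgbot x)).symm⟩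
  have hR := hX.Rpos x
  have := hX.locComp
  obtain ⟨ρ₁, hρ₁, hcomp⟩ := exists_isCompact_closedBall x
  have hev : ∀ᶠ y in nhds x, f y < ((fx + 1 : ℝ) : EReal) :=
    hcont.eventually_lt_const (by rw [hfx, EReal.coe_lt_coe_iff]; linarith)
  obtain ⟨ρ₂, hρ₂, hbdd⟩ := Metric.eventually_nhds_iff.1 hev
  set s := min ρ₁ (min (ρ₂ / 2) (R x)) / 2 with hs
  have hs0 : 0 < s := by positivity
  have hs1 : 2 * s ≤ ρ₁ := by linarith [min_le_left ρ₁ (min (ρ₂ / 2) (R x))]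
  have hs2 : 2 * s ≤ ρ₂ / 2 := by
    linarith [min_le_right ρ₁ (min (ρ₂ / 2) (R x)), min_le_left (ρ₂ / 2) (R x)]
  have hs3 : 2 * s ≤ R x := by
    linarith [min_le_right ρ₁ (min (ρ₂ / 2) (R x)), min_le_right (ρ₂ / 2) (R x)]
  have hzero : ((∀ (w : X) (v : ℝ), f w ≤ v → fx ≤ v) ∧ (∀ (w : X) (v : ℝ), g w ≤ v → gx ≤ v)) →
      ∃ (γ : Geodesic X) (r : ℝ) (η : Geodesic X) (s : ℝ), InTangent x γ r ∧ InTangent x η s ∧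
        IsSubgrad (R x) f x γ r ∧ IsSubgrad (R x) g x η s ∧ TanOpposite γ r η s := by
    rintro ⟨h1, h2⟩
    exact ⟨constGeod x, 0, constGeod x, 0, ⟨rfl, le_rfl, Or.inl rfl⟩, ⟨rfl, le_rfl, Or.inl rfl⟩,
      isSubgrad_zero hR hfx h1, isSubgrad_zero hR hgx h2, Or.inl ⟨rfl, rfl⟩⟩
  rcases exists_opposite_cos_subgradients hk hd hcos hX.geod hX.unique hfbot hgbot
    (lowerSemicontinuous_of_isComplete_sublevel hfbot hfcompl)
    (lowerSemicontinuous_of_isComplete_sublevel hgbot hgcompl) hfconv hgconv hfx hgx hmin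
    (hX.ext x) hD hs0 hs3 (hcomp.of_isClosed_subset Metric.isClosed_closedBall
      (Metric.closedBall_subset_closedBall hs1))
    (fun y hy => (hbdd (by rw [Metric.mem_closedBall] at hy; linarith)).le) with
    hboth | ⟨e₁, e₂, r, hr, hd₁, hd₂, hsep, hsf, hsg⟩
  · exact hzero hboth
  rcases hr.eq_or_lt with hr0 | hr0
  · subst hr0
    exact hzero ⟨by simpa using hsf, by simpa using hsg⟩
  have hray : ∀ e, dist x e = s →
      ∃ γ : Geodesic X, γ.l = R x ∧ γ.map 0 = x ∧ γ.map s = e := by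
    intro e he
    have := hX.ext x x e (Metric.mem_ball_self hR) (by rw [Metric.mem_ball, dist_comm]; linarith)
      (fun h => by rw [← h, dist_self] at he; linarith) (by linarith)
    rwa [he] at this
  obtain ⟨γ, hγl, hγ0, hγs⟩ := hray e₁ hd₁
  obtain ⟨η, hηl, hη0, hηs⟩ := hray e₂ hd₂
  have hks : √κ * s < π / 2 := hd₁ ▸ hd x e₁
  have hks0 : 0 < √κ * s := mul_pos hk hs0
  have hπ := pi_pos
  have hsin : 0 < sin (√κ * s) := sin_pos_of_pos_of_lt_pi hks0 (by linarith)
  have hr' : 0 < r * sin (√κ * s) * √κ := by positivity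
  have hquad : ∀ (h : X → EReal) (c : ℝ) (e : X), (∀ (w : X) (v : ℝ), h w ≤ v →
      c + r * (cos (√κ * dist w e) - cos (√κ * s)) ≤ v) → ∀ (w : X) (v : ℝ), h w ≤ v →
      c + r * sin (√κ * s) * √κ * ((s ^ 2 - dist w e ^ 2) / (2 * s)) ≤ v := by
    intro h c e hyp w v hv
    refine le_trans ?_ (hyp w v hv)
    have h1 := mul_sq_sub_sq_le_cos_sub_cos hks0 (by linarith)
      (mul_nonneg hk.le (dist_nonneg (x := w) (y := e))) (by linarith [hd w e])
    have h2 : r * sin (√κ * s) * √κ * ((s ^ 2 - dist w e ^ 2) / (2 * s)) =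
        r * (sin (√κ * s) * (((√κ * s) ^ 2 - (√κ * dist w e) ^ 2) / (2 * (√κ * s)))) := by
      field_simp
    rw [h2]
    linarith [mul_le_mul_of_nonneg_left h1 hr]
  have hfs := hfconv.isSubgrad_of_quadratic hk hd hcos hX.geod (γ := γ) hr' hs0 (by linarith)
    (by rw [hγ0, hfx]) (by rw [hγs]; exact hquad f fx e₁ hsf)
  have hgs := hgconv.isSubgrad_of_quadratic hk hd hcos hX.geod (γ := η) hr' hs0 (by linarith)
    (by rw [hη0, hgx]) (by rw [hηs]; exact hquad g gx e₂ hsg)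
  rw [hγl, hγ0] at hfs
  rw [hηl, hη0] at hgs
  exact ⟨γ, _, η, _, ⟨hγ0, hr'.le, Or.inr (by linarith)⟩, ⟨hη0, hr'.le, Or.inr (by linarith)⟩,
    hfs, hgs, Or.inr ⟨rfl, hr', alexAngle_eq_pi hs0 (by linarith) (by linarith)
      (hγ0.trans hη0.symm) (by rwa [hγs, hηs])⟩⟩

end CATPaper
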